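/- Let γ_1, …, γ_r ∈ K, let v be a place of K, let j ∈ {1, …, r}, let B ≥ 1 be a real number, and for each i let (P_{n,i})_{n∈ℕ} be a sequence of nonzero polynomials in F_q[t]. Assume: (a) ĥ_v(γ_j) > q^{−d}·max_{i≠j} ĥ_v(γ_i); (b) for all sufficiently large n, deg P_{n,j} > max_{i≠j} deg P_{n,i}; (c) for all n, max_{1≤i≤r} deg P_{n,i} − min_{1≤i≤r} deg P_{n,i} ≤ (log_q B)/d; and (d) deg P_{n,j} → ∞ as n → ∞. Then limsup_{n→∞} log|Σ_{i=1}^r Φ_{P_{n,i}}(γ_i)|_v / (Σ_{i=1}^r q^{d·deg P_{n,i}}) > 0. -/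

import Mathlib

open Polynomial Filter Topology

/-- A family of nonarchimedean places on a field `K`, with absolute values normalized so that
every nonzero `x` satisfies `|x|_v = 1` for all but finitely many places and the product
formula holds. -/
structure PlaceFamily (K : Type) [Field K] where
  Places : Type
  absv : Places → AbsoluteValue K ℝ
  nonarch : ∀ (v : Places) (x y : K), absv v (x + y) ≤ max (absv v x) (absv v y)
  finite_ne_one : ∀ x : K, x ≠ 0 → {v : Places | absv v x ≠ 1}.Finite
  product_formula : ∀ x : K, x ≠ 0 → ∏ᶠ v : Places, absv v x = 1

/-- A Drinfeld module of generic characteristic over `K`: an `𝔽_q`-algebra homomorphism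
`Φ : 𝔽_q[t] → K{τ}`, where an element `Σ b_i τ^i` of the twisted polynomial ring `K{τ}` is
recorded as the additive polynomial `Σ b_i X^{q^i} ∈ K[X]` (composition of polynomials
corresponding to multiplication in `K{τ}`); the coefficient of `τ^0` in `Φ_a` equals `a`
(via the embedding `𝔽_q[t] → K`), and `Φ_t ≠ t·τ^0`. -/
structure DrinfeldModule (Fq K : Type) [Field Fq] [Fintype Fq] [Field K]
    [Algebra (Polynomial Fq) K] where
  toFun : Polynomial Fq → Polynomial K
  map_add' : ∀ a b : Polynomial Fq, toFun (a + b) = toFun a + toFun b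
  map_mul' : ∀ a b : Polynomial Fq, toFun (a * b) = (toFun a).comp (toFun b)
  map_C' : ∀ c : Fq, toFun (Polynomial.C c) =
    Polynomial.C (algebraMap (Polynomial Fq) K (Polynomial.C c)) * Polynomial.X
  coeff_one' : ∀ a : Polynomial Fq, (toFun a).coeff 1 = algebraMap (Polynomial Fq) K a
  support_pow' : ∀ (a : Polynomial Fq) (n : ℕ), (toFun a).coeff n ≠ 0 →
    ∃ i : ℕ, n = (Fintype.card Fq) ^ i
  generic' : toFun Polynomial.X ≠
    Polynomial.C (algebraMap (Polynomial Fq) K Polynomial.X) * Polynomial.X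

namespace DrinfeldModule

variable {Fq K : Type} [Field Fq] [Fintype Fq] [Field K] [Algebra (Polynomial Fq) K]

/-- The action `Φ_a(x)` of `a ∈ 𝔽_q[t]` on `x ∈ 𝔾_a(K)` induced by the Drinfeld module. -/
noncomputable def act (Φ : DrinfeldModule Fq K) (a : Polynomial Fq) (x : K) : K :=
  (Φ.toFun a).eval x

/-- `Φ` has rank `d ≥ 1`, i.e. `Φ_t = Σ_{i=0}^d a_i τ^i` with `a_d ≠ 0`. -/
def HasRank (Φ : DrinfeldModule Fq K) (d : ℕ) : Prop :=
  1 ≤ d ∧ (Φ.toFun Polynomial.X).natDegree = (Fintype.card Fq) ^ d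

/-- `x` is a torsion point for `Φ`. -/
def IsTorsion (Φ : DrinfeldModule Fq K) (x : K) : Prop :=
  ∃ Q : Polynomial Fq, Q ≠ 0 ∧ Φ.act Q x = 0

/-- `hv` is the local canonical height attached to `Φ` (of rank `d`) at the place `v`:
`ĥ_v(x) = lim_{n→∞} log max(|Φ_{t^n}(x)|_v, 1) / q^{nd}`. -/
def IsLocalHeight (Φ : DrinfeldModule Fq K) (d : ℕ) (v : AbsoluteValue K ℝ)
    (hv : K → ℝ) : Prop :=
  ∀ x : K, Tendsto
    (fun n : ℕ => Real.log (max (v (Φ.act (Polynomial.X ^ n) x)) 1) /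
      (Fintype.card Fq : ℝ) ^ (n * d)) atTop (𝓝 (hv x))

end DrinfeldModule

/-- The Weil height `h(x) = Σ_v log max(|x|_v, 1)`. -/
noncomputable def weilHeight {K : Type} [Field K] (P : PlaceFamily K) (x : K) : ℝ :=
  ∑ᶠ v : P.Places, Real.log (max (P.absv v x) 1)

/-- `hh` is the (global) canonical height attached to `Φ` of rank `d`:
`ĥ(x) = lim_{n→∞} h(Φ_{t^n}(x)) / q^{nd}`. -/
def DrinfeldModule.IsCanonicalHeight {Fq K : Type} [Field Fq] [Fintype Fq] [Field K]
    [Algebra (Polynomial Fq) K] (Φ : DrinfeldModule Fq K) (P : PlaceFamily K)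
    (d : ℕ) (hh : K → ℝ) : Prop :=
  ∀ x : K, Tendsto
    (fun n : ℕ => weilHeight P (Φ.act (Polynomial.X ^ n) x) /
      (Fintype.card Fq : ℝ) ^ (n * d)) atTop (𝓝 (hh x))

/-- `β` is `S`-integral with respect to `α`. -/
def SIntegral {K : Type} [Field K] (P : PlaceFamily K) (S : Set P.Places) (α β : K) : Prop :=
  ∀ v : P.Places, v ∉ S →
    (P.absv v α ≤ 1 → 1 ≤ P.absv v (α - β)) ∧
    (1 < P.absv v α → P.absv v β ≤ 1)

/-- `Γ` is a finitely generated `Φ`-submodule: it is generated, as an `A`-module under the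
action `a · x = Φ_a(x)`, by finitely many elements. -/
def DrinfeldModule.FinGen {Fq K : Type} [Field Fq] [Fintype Fq] [Field K]
    [Algebra (Polynomial Fq) K] (Φ : DrinfeldModule Fq K) (Γ : AddSubgroup K) : Prop :=
  ∃ s : Finset K, ∀ x : K, x ∈ Γ ↔ ∃ c : K → Polynomial Fq, x = ∑ g ∈ s, Φ.act (c g) g

open scoped Classical in
/-- `q^{d·deg P}`, with the convention that it equals `0` for the zero polynomial. -/
noncomputable def qdeg {Fq : Type} [Field Fq] [Fintype Fq] (d : ℕ) (P : Polynomial Fq) : ℝ :=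
  if P = 0 then 0 else (Fintype.card Fq : ℝ) ^ (d * P.natDegree)

/-- An ultrametric absolute value of a sum is at least that of a strictly dominant summand. -/
theorem AbsoluteValue.le_add_of_lt_of_nonarch {K : Type} [Field K] {v : AbsoluteValue K ℝ}
    (hna : ∀ x y : K, v (x + y) ≤ max (v x) (v y)) {x y : K} (h : v y < v x) :
    v x ≤ v (x + y) := by
  have h1 := hna (x + y) (-y)
  rw [add_neg_cancel_right, v.map_neg] at h1
  exact (le_max_iff.1 h1).resolve_right h.not_ge

/-- An ultrametric absolute value of a sum is bounded by any common bound of the summands. -/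
theorem AbsoluteValue.sum_le_of_nonarch {K ι : Type} [Field K] {v : AbsoluteValue K ℝ}
    (hna : ∀ x y : K, v (x + y) ≤ max (v x) (v y)) {s : Finset ι} {f : ι → K} {M : ℝ}
    (hM : 0 ≤ M) (h : ∀ i ∈ s, v (f i) ≤ M) : v (∑ i ∈ s, f i) ≤ M :=
  Finset.sum_induction f (fun y => v y ≤ M)
    (fun a b ha hb => (hna a b).trans (max_le ha hb)) (by simpa using hM) h

/-- A monic polynomial `f` satisfies `log⁺ |f(x)| = deg f * log⁺ |x| + O(1)`. -/
theorem Polynomial.Monic.exists_abs_log_max_eval_sub_le {K : Type} [Field K]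
    {v : AbsoluteValue K ℝ} (hna : ∀ x y : K, v (x + y) ≤ max (v x) (v y))
    {f : Polynomial K} (hf : f.Monic) (hdeg : 1 ≤ f.natDegree) :
    ∃ C : ℝ, 0 ≤ C ∧ ∀ x : K, |Real.log (max (v (f.eval x)) 1) -
      (f.natDegree : ℝ) * Real.log (max (v x) 1)| ≤ C := by
  set D := f.natDegree with hD
  set R : ℝ := 1 + ∑ k ∈ Finset.range D, v (f.coeff k) with hR
  have hsum : 0 ≤ ∑ k ∈ Finset.range D, v (f.coeff k) :=
    Finset.sum_nonneg fun _ _ => v.nonneg _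
  have hR1 : 1 ≤ R := by linarith
  have hR0 : 0 < R := by linarith
  have hDR : Real.log R ≤ D * Real.log R :=
    le_mul_of_one_le_left (Real.log_nonneg hR1) (by exact_mod_cast hdeg)
  refine ⟨D * Real.log R, mul_nonneg (Nat.cast_nonneg _) (Real.log_nonneg hR1), fun x => ?_⟩
  set M := max (v x) 1 with hM
  have hM1 : 1 ≤ M := le_max_right _ _
  have hM0 : 0 < M := by linarith
  set low : K := ∑ k ∈ Finset.range D, f.coeff k * x ^ k with hlow
  have heval : f.eval x = x ^ D + low := by
    rw [eval_eq_sum_range, Finset.sum_range_succ, ← hD, hf.coeff_natDegree, one_mul, add_comm]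
  have hlow_le : v low ≤ R * M ^ (D - 1) := by
    refine AbsoluteValue.sum_le_of_nonarch hna (by positivity) fun k hk => ?_
    rw [map_mul, map_pow]
    have hc : v (f.coeff k) ≤ R := by
      have := Finset.single_le_sum (fun i _ => v.nonneg (f.coeff i)) hk
      linarith
    have hp : v x ^ k ≤ M ^ (D - 1) :=
      (pow_le_pow_left₀ (v.nonneg x) (le_max_left _ _) k).trans
        (pow_le_pow_right₀ hM1 (by have := Finset.mem_range.1 hk; omega))
    exact mul_le_mul hc hp (pow_nonneg (v.nonneg x) k) hR0.le
  have hMD : M ^ D = M * M ^ (D - 1) := by rw [← pow_succ']; congr 1; omega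
  have hup : max (v (f.eval x)) 1 ≤ R * M ^ D := by
    have h1 : 1 ≤ M ^ D := one_le_pow₀ hM1
    refine max_le ?_ (by nlinarith)
    rw [heval]
    refine (hna _ _).trans (max_le ?_ (hlow_le.trans ?_))
    · rw [map_pow]
      have := pow_le_pow_left₀ (v.nonneg x) (le_max_left (v x) 1) D
      nlinarith
    · exact mul_le_mul_of_nonneg_left (pow_le_pow_right₀ hM1 (by omega)) hR0.le
  have hlo : M ^ D ≤ R ^ D * max (v (f.eval x)) 1 := by
    have hRD : 1 ≤ R ^ D := one_le_pow₀ hR1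
    rcases le_or_gt M R with h | h
    · exact (pow_le_pow_left₀ hM0.le h D).trans
        (le_mul_of_one_le_right (by positivity) (le_max_right _ _))
    · have hx : v x = M := by
        rcases max_choice (v x) 1 with h2 | h2
        · rw [hM, h2]
        · rw [hM, h2] at h; linarith
      have hxD : v (x ^ D) = M ^ D := by rw [map_pow, hx]
      have hlt : v low < v (x ^ D) := by
        rw [hxD, hMD]
        exact hlow_le.trans_lt (mul_lt_mul_of_pos_right h (by positivity))
      have := AbsoluteValue.le_add_of_lt_of_nonarch hna hlt
      rw [← heval, hxD] at this
      exact (this.trans (le_max_left _ _)).trans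
        (le_mul_of_one_le_left (by positivity) hRD)
  have hE0 : 0 < max (v (f.eval x)) 1 := lt_max_of_lt_right one_pos
  have h1 := Real.log_le_log hE0 hup
  rw [Real.log_mul hR0.ne' (by positivity), Real.log_pow] at h1
  have h2 := Real.log_le_log (by positivity) hlo
  rw [Real.log_mul (by positivity) hE0.ne', Real.log_pow, Real.log_pow] at h2
  rw [abs_le]
  constructor <;> linarith

namespace DrinfeldModule

variable {Fq K : Type} [Field Fq] [Fintype Fq] [Field K] [Algebra (Polynomial Fq) K]
  (Φ : DrinfeldModule Fq K)

theorem act_add (a b : Polynomial Fq) (x : K) : Φ.act (a + b) x = Φ.act a x + Φ.act b x := by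
  simp [act, Φ.map_add']

theorem act_mul (a b : Polynomial Fq) (x : K) : Φ.act (a * b) x = Φ.act a (Φ.act b x) := by
  simp [act, Φ.map_mul']

theorem act_C (c : Fq) (x : K) : Φ.act (C c) x = algebraMap (Polynomial Fq) K (C c) * x := by
  simp [act, Φ.map_C']

/-- The action on a fixed point, as an additive homomorphism in the acting polynomial. -/
noncomputable def actHom (x : K) : Polynomial Fq →+ K :=
  AddMonoidHom.mk' (fun a => Φ.act a x) fun a b => Φ.act_add a b x

theorem act_sum {ι : Type} (s : Finset ι) (f : ι → Polynomial Fq) (x : K) :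
    Φ.act (∑ i ∈ s, f i) x = ∑ i ∈ s, Φ.act (f i) x :=
  map_sum (Φ.actHom x) f s

theorem act_X_pow_succ (n : ℕ) (x : K) :
    Φ.act (X ^ (n + 1)) x = (Φ.toFun X).eval (Φ.act (X ^ n) x) := by
  rw [pow_succ', act_mul]; rfl

theorem act_one (x : K) : Φ.act 1 x = x := by
  rw [← C_1, act_C]; simp

theorem act_C_mul_X_pow (c : Fq) (n : ℕ) (x : K) :
    Φ.act (C c * X ^ n) x = algebraMap (Polynomial Fq) K (C c) * Φ.act (X ^ n) x := by
  rw [act_mul, act_C]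

theorem absv_algebraMap_C (v : AbsoluteValue K ℝ) {c : Fq} (hc : c ≠ 0) :
    v (algebraMap (Polynomial Fq) K (C c)) = 1 := by
  have h : v (algebraMap (Polynomial Fq) K (C c)) ^ (Fintype.card Fq - 1) = 1 := by
    rw [← map_pow, ← map_pow, ← C_pow, FiniteField.pow_card_sub_one_eq_one c hc]
    simp
  have hq : Fintype.card Fq - 1 ≠ 0 := by
    have := Fintype.one_lt_card (α := Fq); omega
  exact (pow_eq_one_iff_of_nonneg (v.nonneg _) hq).1 h

variable {Φ}
variable {v : AbsoluteValue K ℝ}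

theorem absv_act_le (hna : ∀ x y : K, v (x + y) ≤ max (v x) (v y)) {P : Polynomial Fq}
    {n : ℕ} (hP : P.degree < n) {x : K} {M : ℝ} (hM : 0 ≤ M)
    (h : ∀ k < n, v (Φ.act (X ^ k) x) ≤ M) : v (Φ.act P x) ≤ M := by
  rcases eq_or_ne P 0 with rfl | hP0
  · have : Φ.act 0 x = 0 := map_zero (Φ.actHom x)
    simpa [this] using hM
  rw [P.as_sum_range' n ((natDegree_lt_iff_degree_lt hP0).2 hP), act_sum]
  refine AbsoluteValue.sum_le_of_nonarch hna hM fun k hk => ?_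
  rw [← C_mul_X_pow_eq_monomial, act_C_mul_X_pow, map_mul]
  rcases eq_or_ne (P.coeff k) 0 with h0 | h0
  · simpa [h0] using hM
  · rw [absv_algebraMap_C v h0, one_mul]
    exact h k (Finset.mem_range.1 hk)

/-- If the leading monomial of `P` strictly dominates all lower powers of `t` at `x`, then
`|Φ_P(x)|` is at least the absolute value of that monomial. -/
theorem le_absv_act (hna : ∀ x y : K, v (x + y) ≤ max (v x) (v y)) {P : Polynomial Fq}
    (hP : P ≠ 0) {x : K} {M : ℝ} (hM : 0 ≤ M)
    (h : ∀ k < P.natDegree, v (Φ.act (X ^ k) x) ≤ M)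
    (hlt : M < v (Φ.act (X ^ P.natDegree) x)) :
    v (Φ.act (X ^ P.natDegree) x) ≤ v (Φ.act P x) := by
  have hlead : v (Φ.act (C P.leadingCoeff * X ^ P.natDegree) x) =
      v (Φ.act (X ^ P.natDegree) x) := by
    rw [act_C_mul_X_pow, map_mul, absv_algebraMap_C v (leadingCoeff_ne_zero.2 hP), one_mul]
  have hlow : v (Φ.act P.eraseLead x) ≤ M :=
    absv_act_le hna ((degree_eraseLead_lt hP).trans_eq (degree_eq_natDegree hP)) hM h
  have := AbsoluteValue.le_add_of_lt_of_nonarch hna (hlow.trans_lt (hlt.trans_eq hlead.symm))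
  rwa [hlead, ← act_add, add_comm, eraseLead_add_C_mul_X_pow] at this

variable {d : ℕ} {hv : K → ℝ}

theorem IsLocalHeight.nonneg (hloc : Φ.IsLocalHeight d v hv) (x : K) : 0 ≤ hv x :=
  ge_of_tendsto' (hloc x) fun _ =>
    div_nonneg (Real.log_nonneg (le_max_right _ _)) (by positivity)

theorem IsLocalHeight.act_X_pow (hloc : Φ.IsLocalHeight d v hv) (k : ℕ) (x : K) :
    hv (Φ.act (X ^ k) x) = ((Fintype.card Fq : ℝ) ^ d) ^ k * hv x := by
  have hq : (Fintype.card Fq : ℝ) ≠ 0 := by exact_mod_cast Fintype.card_ne_zero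
  refine tendsto_nhds_unique (hloc _)
    ((((tendsto_add_atTop_iff_nat k).2 (hloc x)).const_mul _).congr fun n => ?_)
  rw [pow_add, act_mul, add_mul, pow_add, ← pow_mul, mul_comm d k]
  field_simp

/-- The local height differs from `log⁺ |·|_v` by a bounded amount. -/
theorem IsLocalHeight.exists_abs_log_sub_le (hrank : Φ.HasRank d)
    (hmonic : (Φ.toFun X).Monic) (hna : ∀ x y : K, v (x + y) ≤ max (v x) (v y))
    (hloc : Φ.IsLocalHeight d v hv) :
    ∃ C : ℝ, 0 ≤ C ∧ ∀ x : K, |Real.log (max (v x) 1) - hv x| ≤ C := by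
  obtain ⟨hd, hdeg⟩ := hrank
  have hcard : 1 < Fintype.card Fq := Fintype.one_lt_card
  have hD2 : 2 ≤ Fintype.card Fq ^ d := hcard.trans_le (Nat.le_self_pow (by omega) _)
  obtain ⟨C, hC, h⟩ := hmonic.exists_abs_log_max_eval_sub_le hna (by omega)
  rw [hdeg] at h
  push_cast at h
  set D : ℝ := (Fintype.card Fq : ℝ) ^ d with hD
  have hDR : 2 ≤ D := by rw [hD]; exact_mod_cast hD2
  refine ⟨C, hC, fun x => ?_⟩
  have hind : ∀ n : ℕ, |Real.log (max (v (Φ.act (X ^ n) x)) 1) -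
      D ^ n * Real.log (max (v x) 1)| ≤ C * (D ^ n - 1) := by
    intro n
    induction n with
    | zero => simp [act_one]
    | succ n ih =>
      have h1 := h (Φ.act (X ^ n) x)
      rw [← act_X_pow_succ] at h1
      rw [abs_le] at h1 ih ⊢
      rw [pow_succ']
      constructor <;> nlinarith
  have hlim := (((hloc x).const_sub (Real.log (max (v x) 1))).abs)
  refine le_of_tendsto' hlim fun n => ?_
  have hDn : 0 < D ^ n := by positivity
  have hq : (Fintype.card Fq : ℝ) ^ (n * d) = D ^ n := by rw [hD, ← pow_mul, mul_comm]
  have h2 := hind n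
  rw [hq, abs_sub_comm, div_sub' hDn.ne', abs_div, abs_of_pos hDn, div_le_iff₀ hDn]
  nlinarith

end DrinfeldModule

/-- **Claim (dominant-term positivity).** Let `γ_1, …, γ_r ∈ K`, let `v` be a place of `K`,
let `j`, let `B ≥ 1`, and for each `i` let `(P_{n,i})_n` be a sequence of nonzero polynomials
in `𝔽_q[t]`. Assume: (a) `ĥ_v(γ_j) > q^{−d}·max_{i≠j} ĥ_v(γ_i)` (in particular
`ĥ_v(γ_j) > 0`); (b) for all sufficiently large `n`, `deg P_{n,j} > max_{i≠j} deg P_{n,i}`;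
(c) for all `n`, `max_i deg P_{n,i} − min_i deg P_{n,i} ≤ (log_q B)/d`; and (d)
`deg P_{n,j} → ∞`. Then
`limsup_n log|Σ_i Φ_{P_{n,i}}(γ_i)|_v / (Σ_i q^{d·deg P_{n,i}}) > 0`. -/
theorem limsup_pos_of_dominant_term
    {Fq K : Type} [Field Fq] [Fintype Fq] [Field K]
    [Algebra (Polynomial Fq) K] [Algebra (RatFunc Fq) K]
    [IsScalarTower (Polynomial Fq) (RatFunc Fq) K] [FiniteDimensional (RatFunc Fq) K]
    (Φ : DrinfeldModule Fq K) (d : ℕ) (hrank : Φ.HasRank d)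
    (hmonic : (Φ.toFun Polynomial.X).Monic)
    (v : AbsoluteValue K ℝ) (hnonarch : ∀ x y : K, v (x + y) ≤ max (v x) (v y))
    (hv : K → ℝ) (hloc : Φ.IsLocalHeight d v hv)
    (r : ℕ) (γ : Fin r → K) (j : Fin r) (B : ℝ) (hB : 1 ≤ B)
    (Pn : ℕ → Fin r → Polynomial Fq) (hne : ∀ n i, Pn n i ≠ 0)
    (ha₁ : 0 < hv (γ j))
    (ha₂ : ∀ i : Fin r, i ≠ j → hv (γ i) / (Fintype.card Fq : ℝ) ^ d < hv (γ j))
    (hb : ∀ᶠ n in atTop, ∀ i : Fin r, i ≠ j → (Pn n i).natDegree < (Pn n j).natDegree)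
    (hc : ∀ n : ℕ, ∀ i i' : Fin r,
      ((Pn n i).natDegree : ℝ) - ((Pn n i').natDegree : ℝ) ≤
        Real.logb (Fintype.card Fq) B / d)
    (hd' : Filter.Tendsto (fun n => (Pn n j).natDegree) atTop atTop) :
    0 < Filter.limsup (fun n : ℕ =>
      ((Real.log (v (∑ i, Φ.act (Pn n i) (γ i))) /
        (∑ i, (Fintype.card Fq : ℝ) ^ (d * (Pn n i).natDegree)) : ℝ) : EReal)) atTop := by
  obtain ⟨C, hC, hbd⟩ := hloc.exists_abs_log_sub_le hrank hmonic hnonarch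
  have hcard : 1 < Fintype.card Fq := Fintype.one_lt_card
  have hd0 : d ≠ 0 := by have := hrank.1; omega
  have hDR : 1 < (Fintype.card Fq : ℝ) ^ d := one_lt_pow₀ (by exact_mod_cast hcard) hd0
  simp only [pow_mul]
  set D : ℝ := (Fintype.card Fq : ℝ) ^ d with hD
  have hD0 : 0 < D := by linarith
  have hlower : ∀ (k : ℕ) (x : K),
      D ^ k * hv x - C ≤ Real.log (max (v (Φ.act (X ^ k) x)) 1) := fun k x => by
    have := (abs_le.1 (hbd (Φ.act (X ^ k) x))).1
    rw [hloc.act_X_pow] at this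
    linarith
  have hupper : ∀ (k m : ℕ) (x : K), k ≤ m →
      v (Φ.act (X ^ k) x) ≤ Real.exp (D ^ m * hv x + C) := fun k m x hkm => by
    have h1 := (abs_le.1 (hbd (Φ.act (X ^ k) x))).2
    rw [hloc.act_X_pow] at h1
    have h2 := mul_le_mul_of_nonneg_right (pow_le_pow_right₀ hDR.le hkm) (hloc.nonneg x)
    refine (le_max_left _ 1).trans ?_
    rw [← Real.log_le_iff_le_exp (lt_max_of_lt_right one_pos)]
    linarith
  set m : ℕ → ℕ := fun n => (Pn n j).natDegree with hm
  have hDm : Tendsto (fun n => D ^ m n) atTop atTop :=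
    (tendsto_pow_atTop_atTop_of_one_lt hDR).comp hd'
  have hlarge : ∀ (c e : ℝ), 0 < e → ∀ᶠ n in atTop, c < D ^ m n * e := fun c e he =>
    (hDm.atTop_mul_const he).eventually_gt_atTop c
  have hothers : ∀ᶠ n in atTop, ∀ i, i ≠ j →
      2 * C < D ^ m n * (hv (γ j) - hv (γ i) / D) :=
    eventually_all.2 fun i => by
      by_cases hi : i = j
      · simp [hi]
      · filter_upwards [hlarge (2 * C) _ (sub_pos.2 (ha₂ i hi))] with n hn _ using hn
  have hself : 0 < hv (γ j) - hv (γ j) / D := sub_pos.2 (div_lt_self ha₁ hDR)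
  have hr : (0 : ℝ) < r := by exact_mod_cast j.pos
  have key : ∀ᶠ n in atTop, hv (γ j) / (2 * r) ≤
      Real.log (v (∑ i, Φ.act (Pn n i) (γ i))) / ∑ i, D ^ (Pn n i).natDegree := by
    filter_upwards [hb, hothers, hlarge (2 * C) _ hself, hlarge (2 * C) _ ha₁,
      hd'.eventually_ge_atTop 1] with n hbn hon hsn hpn hmn
    have hpred : ∀ y : ℝ, D ^ (m n - 1) * y = D ^ m n * (y / D) := fun y => by
      obtain ⟨l, hl⟩ : ∃ l, m n = l + 1 := ⟨m n - 1, (Nat.sub_add_cancel hmn).symm⟩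
      rw [hl, Nat.add_sub_cancel, pow_succ]
      field_simp
    -- size of the leading monomial at `γ j`
    have hlead : Real.exp (D ^ m n * hv (γ j) - C) ≤ v (Φ.act (X ^ m n) (γ j)) := by
      have h1 := hlower (m n) (γ j)
      rw [Real.le_log_iff_exp_le (lt_max_of_lt_right one_pos)] at h1
      exact (le_max_iff.1 h1).resolve_right (by rw [not_le, Real.one_lt_exp_iff]; linarith)
    have hlt : ∀ i, 2 * C < D ^ m n * (hv (γ j) - hv (γ i) / D) →
        Real.exp (D ^ (m n - 1) * hv (γ i) + C) < Real.exp (D ^ m n * hv (γ j) - C) :=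
      fun i hi => by
        rw [Real.exp_lt_exp, hpred]
        linarith
    have hj : Real.exp (D ^ m n * hv (γ j) - C) ≤ v (Φ.act (Pn n j) (γ j)) :=
      hlead.trans (DrinfeldModule.le_absv_act hnonarch (hne n j) (Real.exp_pos _).le
        (fun k hk => hupper k (m n - 1) (γ j) (Nat.le_sub_one_of_lt hk))
        ((hlt j hsn).trans_le hlead))
    have hi : ∀ i, i ≠ j → v (Φ.act (Pn n i) (γ i)) < Real.exp (D ^ m n * hv (γ j) - C) :=
      fun i hij => (DrinfeldModule.absv_act_le hnonarch
        (degree_le_natDegree.trans_lt (by exact_mod_cast hbn i hij)) (Real.exp_pos _).le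
        fun k hk => hupper k (m n - 1) (γ i) (Nat.le_sub_one_of_lt hk)).trans_lt
          (hlt i (hon i hij))
    have hrest : v (∑ i ∈ Finset.univ.erase j, Φ.act (Pn n i) (γ i)) <
        v (Φ.act (Pn n j) (γ j)) := by
      refine lt_of_lt_of_le ?_ hj
      exact Finset.sum_induction _ (fun y => v y < Real.exp (D ^ m n * hv (γ j) - C))
        (fun a b ha hb => (hnonarch a b).trans_lt (max_lt ha hb))
        (by simpa using Real.exp_pos _) fun i hi' => hi i (Finset.ne_of_mem_erase hi')
    have htot : Real.exp (D ^ m n * hv (γ j) - C) ≤ v (∑ i, Φ.act (Pn n i) (γ i)) := by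
      rw [← Finset.add_sum_erase _ _ (Finset.mem_univ j)]
      exact hj.trans (AbsoluteValue.le_add_of_lt_of_nonarch hnonarch hrest)
    have hlog := (Real.le_log_iff_exp_le ((Real.exp_pos _).trans_le htot)).2 htot
    have hden : ∑ i, D ^ (Pn n i).natDegree ≤ r * D ^ m n := by
      have := Finset.sum_le_card_nsmul Finset.univ (fun i => D ^ (Pn n i).natDegree) (D ^ m n)
        fun i _ => pow_le_pow_right₀ hDR.le (by
          by_cases hij : i = j
          · rw [hij]
          · exact (hbn i hij).le)
      simpa using this
    have hden0 : 0 < ∑ i, D ^ (Pn n i).natDegree :=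
      Finset.sum_pos (fun i _ => by positivity) ⟨j, Finset.mem_univ j⟩
    rw [le_div_iff₀ hden0]
    calc hv (γ j) / (2 * r) * ∑ i, D ^ (Pn n i).natDegree
        ≤ hv (γ j) / (2 * r) * (r * D ^ m n) := by gcongr
      _ = D ^ m n * hv (γ j) / 2 := by field_simp
      _ ≤ _ := by linarith
  refine lt_of_lt_of_le (b := ((hv (γ j) / (2 * r) : ℝ) : EReal))
    (by exact_mod_cast div_pos ha₁ (mul_pos two_pos hr)) ?_
  exact le_limsup_of_frequently_le
    (key.mono fun n hn => EReal.coe_le_coe_iff.2 hn).frequently
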